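/- For all natural numbers d, the d-th power of the intersection K ∩ K' ∩ K'' equals the intersection of the d-th powers K^d ∩ (K')^d ∩ (K'')^d, where K = (z1,z2), K' = (z3,z4), K'' = (z1+z3,z2+z4) in C[z1,z2,z3,z4]. -/

import Mathlib

open MvPolynomial

noncomputable def Kz : Ideal (MvPolynomial (Fin 4) ℂ) := Ideal.span {X 0, X 1}
noncomputable def Kz' : Ideal (MvPolynomial (Fin 4) ℂ) := Ideal.span {X 2, X 3}
noncomputable def Kz'' : Ideal (MvPolynomial (Fin 4) ℂ) :=
  Ideal.span {X 0 + X 2, X 1 + X 3}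

section ReesSection

variable {R : Type*} [CommRing R] {I : Ideal R}

/-- If a ring endomorphism `ψ` into `R[t]` lands in the Rees algebra of `I`, specializes to the
identity at `t = 1`, and sends `I` into `(t)`, then `t`-divisibility detects the powers of `I`. -/
theorem mem_pow_iff_X_pow_dvd (ψ : R →+* Polynomial R)
    (hψ : ∀ r, ψ r ∈ reesAlgebra I) (hone : ∀ r, (ψ r).eval 1 = r)
    (hI : I ≤ (Ideal.span {Polynomial.X}).comap ψ) (d : ℕ) (r : R) :
    r ∈ I ^ d ↔ Polynomial.X ^ d ∣ ψ r := by
  constructor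
  · intro hr
    have h : r ∈ ((Ideal.span {Polynomial.X}).comap ψ) ^ d := Ideal.pow_right_mono hI d hr
    have h' := Ideal.le_comap_pow ψ d h
    rwa [Ideal.mem_comap, Ideal.span_singleton_pow, Ideal.mem_span_singleton] at h'
  · intro hr
    rw [← hone r, Polynomial.eval_eq_sum, Polynomial.sum]
    refine Ideal.sum_mem _ fun k hk => ?_
    rw [one_pow, mul_one]
    have hdk : d ≤ k := by
      by_contra! hlt
      exact Polynomial.mem_support_iff.1 hk (Polynomial.X_pow_dvd_iff.1 hr k hlt)
    exact Ideal.pow_le_pow_right hdk ((mem_reesAlgebra_iff I _).1 (hψ r) k)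

/-- Dividing by a nonzero element of exact `I`-adic order one lowers the order by at most one. -/
theorem mem_pow_of_mul_mem_pow_succ [IsDomain R] (ψ : R →+* Polynomial R)
    (hψ : ∀ r, ψ r ∈ reesAlgebra I) (hone : ∀ r, (ψ r).eval 1 = r)
    (hI : I ≤ (Ideal.span {Polynomial.X}).comap ψ) {D : R} (hD : D ≠ 0)
    (hψD : ψ D = Polynomial.X * Polynomial.C D) {d : ℕ} {r : R} (h : D * r ∈ I ^ (d + 1)) :
    r ∈ I ^ d := by
  rw [mem_pow_iff_X_pow_dvd ψ hψ hone hI] at h ⊢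
  rw [map_mul, hψD, pow_succ', mul_assoc] at h
  have h' := (mul_dvd_mul_iff_left Polynomial.X_ne_zero).1 h
  refine Polynomial.prime_X.pow_dvd_of_dvd_mul_left d ?_ h'
  rw [Polynomial.X_dvd_iff, Polynomial.coeff_C_zero]
  exact hD

end ReesSection

noncomputable section

/-- The polynomial ring in four variables. -/
abbrev FourPoly : Type := MvPolynomial (Fin 4) ℂ

/-- The determinant of the generic `2 × 2` matrix. -/
def detPoly : FourPoly := X 0 * X 3 - X 1 * X 2

theorem X_zero_not_dvd_detPoly : ¬ (X 0 : FourPoly) ∣ detPoly := by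
  rintro ⟨q, hq⟩
  have := congrArg (eval ![0, 1, 1, 0]) hq
  simp [detPoly] at this

theorem detPoly_ne_zero : detPoly ≠ 0 := fun h =>
  X_zero_not_dvd_detPoly (h ▸ dvd_zero _)

theorem mem_pow_of_detPoly_mul_mem {I : Ideal FourPoly} (w : Fin 4 → Polynomial FourPoly)
    (hw : ∀ i, w i ∈ reesAlgebra I) (hone : ∀ i, (w i).eval 1 = X i)
    (hI : I ≤ (Ideal.span {Polynomial.X}).comap (aeval (R := ℂ) w).toRingHom)
    (hD : aeval (R := ℂ) w detPoly = Polynomial.X * Polynomial.C detPoly) {d : ℕ} {r : FourPoly}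
    (h : detPoly * r ∈ I ^ (d + 1)) : r ∈ I ^ d := by
  refine mem_pow_of_mul_mem_pow_succ (aeval (R := ℂ) w).toRingHom ?_ ?_ hI detPoly_ne_zero hD h
  · intro r
    change aeval (R := ℂ) w r ∈ reesAlgebra I
    induction r using MvPolynomial.induction_on with
    | C c =>
      rw [MvPolynomial.aeval_C]
      exact (reesAlgebra I).algebraMap_mem (C c)
    | add p q hp hq => rw [map_add]; exact add_mem hp hq
    | mul_X p i hp => rw [map_mul, aeval_X]; exact mul_mem hp (hw i)
  · intro r
    change (aeval (R := ℂ) w r).eval 1 = r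
    induction r using MvPolynomial.induction_on with
    | C c =>
      rw [MvPolynomial.aeval_C]
      exact Polynomial.eval_C
    | add p q hp hq => rw [map_add, Polynomial.eval_add, hp, hq]
    | mul_X p i hp => rw [map_mul, aeval_X, Polynomial.eval_mul, hp, hone]

theorem C_mem_reesAlgebra (I : Ideal FourPoly) (r : FourPoly) :
    Polynomial.C r ∈ reesAlgebra I := (reesAlgebra I).algebraMap_mem r

theorem X_mul_C_mem_reesAlgebra {I : Ideal FourPoly} {r : FourPoly} (hr : r ∈ I) :
    Polynomial.X * Polynomial.C r ∈ reesAlgebra I := by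
  rw [mul_comm, Polynomial.C_mul_X_eq_monomial]
  exact reesAlgebra.monomial_mem.2 (by simpa using hr)

theorem mem_Kz_pow_of_detPoly_mul_mem {d : ℕ} {r : FourPoly} (h : detPoly * r ∈ Kz ^ (d + 1)) :
    r ∈ Kz ^ d := by
  refine mem_pow_of_detPoly_mul_mem
    ![Polynomial.X * Polynomial.C (X 0), Polynomial.X * Polynomial.C (X 1),
      Polynomial.C (X 2), Polynomial.C (X 3)] ?_ ?_ ?_ ?_ h
  · intro i
    fin_cases i
    · exact X_mul_C_mem_reesAlgebra (Ideal.subset_span (by simp))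
    · exact X_mul_C_mem_reesAlgebra (Ideal.subset_span (by simp))
    · exact C_mem_reesAlgebra _ _
    · exact C_mem_reesAlgebra _ _
  · intro i
    fin_cases i <;> simp
  · rw [Kz, Ideal.span_le]
    rintro x (rfl | rfl) <;> simp [Ideal.mem_span_singleton]
  · simp [detPoly]
    ring

theorem mem_Kz'_pow_of_detPoly_mul_mem {d : ℕ} {r : FourPoly} (h : detPoly * r ∈ Kz' ^ (d + 1)) :
    r ∈ Kz' ^ d := by
  refine mem_pow_of_detPoly_mul_mem
    ![Polynomial.C (X 0), Polynomial.C (X 1),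
      Polynomial.X * Polynomial.C (X 2), Polynomial.X * Polynomial.C (X 3)] ?_ ?_ ?_ ?_ h
  · intro i
    fin_cases i
    · exact C_mem_reesAlgebra _ _
    · exact C_mem_reesAlgebra _ _
    · exact X_mul_C_mem_reesAlgebra (Ideal.subset_span (by simp))
    · exact X_mul_C_mem_reesAlgebra (Ideal.subset_span (by simp))
  · intro i
    fin_cases i <;> simp
  · rw [Kz', Ideal.span_le]
    rintro x (rfl | rfl) <;> simp [Ideal.mem_span_singleton]
  · simp [detPoly]
    ring

theorem mem_Kz''_pow_of_detPoly_mul_mem {d : ℕ} {r : FourPoly}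
    (h : detPoly * r ∈ Kz'' ^ (d + 1)) : r ∈ Kz'' ^ d := by
  refine mem_pow_of_detPoly_mul_mem
    ![Polynomial.C (X 0), Polynomial.C (X 1),
      Polynomial.X * Polynomial.C (X 0 + X 2) - Polynomial.C (X 0),
      Polynomial.X * Polynomial.C (X 1 + X 3) - Polynomial.C (X 1)] ?_ ?_ ?_ ?_ h
  · intro i
    fin_cases i
    · exact C_mem_reesAlgebra _ _
    · exact C_mem_reesAlgebra _ _
    · exact sub_mem (X_mul_C_mem_reesAlgebra (Ideal.subset_span (by simp)))
        (C_mem_reesAlgebra _ _)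
    · exact sub_mem (X_mul_C_mem_reesAlgebra (Ideal.subset_span (by simp)))
        (C_mem_reesAlgebra _ _)
  · intro i
    fin_cases i <;> simp
  · rw [Kz'', Ideal.span_le]
    rintro x (rfl | rfl) <;> simp [Ideal.mem_span_singleton]
  · simp [detPoly]
    ring

/-- The parametrization of singular `2 × 2` matrices by pairs of vectors. -/
def segre : FourPoly →ₐ[ℂ] FourPoly :=
  aeval ![X 0 * X 2, X 0 * X 3, X 1 * X 2, X 1 * X 3]

@[simp] theorem segre_X_zero : segre (X 0) = X 0 * X 2 := by simp [segre]
@[simp] theorem segre_X_one : segre (X 1) = X 0 * X 3 := by simp [segre]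
@[simp] theorem segre_X_two : segre (X 2) = X 1 * X 2 := by simp [segre]
@[simp] theorem segre_X_three : segre (X 3) = X 1 * X 3 := by simp [segre]

theorem detPoly_dvd_of_X_zero_pow_mul {n : ℕ} {r : FourPoly} (h : detPoly ∣ r * X 0 ^ n) :
    detPoly ∣ r := by
  obtain ⟨q, hq⟩ := h
  have hp : Prime (X 0 : FourPoly) := X_prime
  obtain ⟨q', rfl⟩ := hp.pow_dvd_of_dvd_mul_left n X_zero_not_dvd_detPoly
    (Dvd.intro_left r hq)
  refine ⟨q', mul_right_cancel₀ (pow_ne_zero n hp.ne_zero) (hq.trans ?_)⟩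
  ring

theorem detPoly_dvd_of_segre_eq_zero {f : FourPoly} (hf : segre f = 0) : detPoly ∣ f := by
  let scale : FourPoly →ₐ[ℂ] Polynomial FourPoly :=
    aeval fun i => Polynomial.C (X i) * Polynomial.X
  let lift : FourPoly →ₐ[ℂ] Polynomial FourPoly :=
    aeval ![Polynomial.X * Polynomial.C (X 0), Polynomial.X * Polynomial.C (X 2),
      Polynomial.C (X 0), Polynomial.C (X 1)]
  have hcongr : ∀ g, Polynomial.C detPoly ∣
      (scale g).comp (Polynomial.C (X 0) * Polynomial.X) - lift (segre g) := by
    intro g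
    induction g using MvPolynomial.induction_on with
    | C c =>
      have : algebraMap ℂ (Polynomial FourPoly) c = Polynomial.C (C c) := rfl
      have h₁ : scale (C c) = Polynomial.C (C c) := by rw [← this]; exact scale.commutes c
      have h₂ : lift (segre (C c)) = Polynomial.C (C c) := by
        rw [← this]; exact (lift.comp segre).commutes c
      rw [h₁, h₂, Polynomial.C_comp, sub_self]
      exact dvd_zero _
    | add p q hp hq =>
      simp only [map_add, Polynomial.add_comp]
      rw [add_sub_add_comm]
      exact dvd_add hp hq
    | mul_X p i hp =>
      simp only [map_mul, Polynomial.mul_comp]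
      refine dvd_mul_sub_mul hp ?_
      fin_cases i
      · exact ⟨0, by simp [scale, lift]; ring⟩
      · exact ⟨0, by simp [scale, lift]; ring⟩
      · exact ⟨0, by simp [scale, lift]; ring⟩
      · exact ⟨Polynomial.X, by simp [scale, lift, detPoly]; ring⟩
  have hone : ∀ g, (scale g).eval 1 = g := by
    intro g
    induction g using MvPolynomial.induction_on with
    | C c =>
      have h₁ : scale (C c) = Polynomial.C (C c) := scale.commutes c
      rw [h₁, Polynomial.eval_C]
    | add p q hp hq => rw [map_add, Polynomial.eval_add, hp, hq]
    | mul_X p i hp => rw [map_mul, Polynomial.eval_mul, hp]; simp [scale]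
  have h := hcongr f
  rw [hf, map_zero, sub_zero, Polynomial.C_dvd_iff_dvd_coeff] at h
  rw [← hone f, Polynomial.eval_eq_sum, Polynomial.sum]
  refine Finset.dvd_sum fun k _ => ?_
  rw [one_pow, mul_one]
  have hk := h k
  rw [Polynomial.comp_C_mul_X_coeff] at hk
  exact detPoly_dvd_of_X_zero_pow_mul hk

theorem prod_mem_inf {x y z : FourPoly} (hx : x ∈ Kz) (hy : y ∈ Kz') (hz : z ∈ Kz'') :
    x * y * z ∈ Kz ⊓ Kz' ⊓ Kz'' :=
  ⟨⟨Ideal.mul_mem_right _ _ (Ideal.mul_mem_right _ _ hx),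
    Ideal.mul_mem_right _ _ (Ideal.mul_mem_left _ _ hy)⟩, Ideal.mul_mem_left _ _ hz⟩

theorem detPoly_mem_inf : detPoly ∈ Kz ⊓ Kz' ⊓ Kz'' := by
  refine ⟨⟨?_, ?_⟩, ?_⟩
  · exact Ideal.mem_span_pair.2 ⟨X 3, -X 2, by rw [detPoly]; ring⟩
  · exact Ideal.mem_span_pair.2 ⟨-X 1, X 0, by rw [detPoly]; ring⟩
  · exact Ideal.mem_span_pair.2 ⟨-X 1, X 0, by rw [detPoly]; ring⟩

/-- The product of the three linear forms cutting out the images of the ideals under `segre`. -/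
def tripleForm : FourPoly := X 0 * X 1 * (X 0 + X 1)

theorem exists_mem_inf_segre_eq {k l : ℕ} (h : k + l = 3) :
    ∃ g ∈ Kz ⊓ Kz' ⊓ Kz'', segre g = tripleForm * (X 2 ^ k * X 3 ^ l) := by
  have h0 : (X 0 : FourPoly) ∈ Kz := Ideal.subset_span (by simp)
  have h1 : (X 1 : FourPoly) ∈ Kz := Ideal.subset_span (by simp)
  have h2 : (X 2 : FourPoly) ∈ Kz' := Ideal.subset_span (by simp)
  have h3 : (X 3 : FourPoly) ∈ Kz' := Ideal.subset_span (by simp)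
  have h4 : (X 0 + X 2 : FourPoly) ∈ Kz'' := Ideal.subset_span (by simp)
  have h5 : (X 1 + X 3 : FourPoly) ∈ Kz'' := Ideal.subset_span (by simp)
  obtain ⟨rfl, rfl⟩ | ⟨rfl, rfl⟩ | ⟨rfl, rfl⟩ | ⟨rfl, rfl⟩ :
      k = 3 ∧ l = 0 ∨ k = 2 ∧ l = 1 ∨ k = 1 ∧ l = 2 ∨ k = 0 ∧ l = 3 := by omega
  · exact ⟨_, prod_mem_inf h0 h2 h4, by simp [tripleForm]; ring⟩
  · exact ⟨_, prod_mem_inf h0 h2 h5, by simp [tripleForm]; ring⟩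
  · exact ⟨_, prod_mem_inf h0 h3 h5, by simp [tripleForm]; ring⟩
  · exact ⟨_, prod_mem_inf h1 h3 h5, by simp [tripleForm]; ring⟩

theorem exists_segre_eq_monomial {i j k l : ℕ} (h : k + l = i + j) :
    ∃ g, segre g = X 0 ^ i * X 1 ^ j * (X 2 ^ k * X 3 ^ l) := by
  obtain hik | hki := le_total i k
  · obtain ⟨m, rfl⟩ := Nat.exists_eq_add_of_le hik
    obtain rfl : j = m + l := by omega
    exact ⟨X 0 ^ i * X 2 ^ m * X 3 ^ l, by simp; ring⟩
  · obtain ⟨m, rfl⟩ := Nat.exists_eq_add_of_le hki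
    obtain rfl : l = m + j := by omega
    exact ⟨X 0 ^ k * X 1 ^ m * X 3 ^ j, by simp; ring⟩

theorem exists_mem_inf_pow_segre_eq (d : ℕ) {i j k l : ℕ} (h : k + l = 3 * d + (i + j)) :
    ∃ g ∈ (Kz ⊓ Kz' ⊓ Kz'') ^ d,
      segre g = tripleForm ^ d * (X 0 ^ i * X 1 ^ j * (X 2 ^ k * X 3 ^ l)) := by
  induction d generalizing k l with
  | zero =>
    obtain ⟨g, hg⟩ := exists_segre_eq_monomial (i := i) (j := j) (k := k) (l := l) (by omega)
    exact ⟨g, by simp, by rw [hg, pow_zero, one_mul]⟩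
  | succ d ih =>
    obtain ⟨k₁, l₁, k₂, l₂, h₁, rfl, rfl⟩ :
        ∃ k₁ l₁ k₂ l₂, k₁ + l₁ = 3 ∧ k = k₁ + k₂ ∧ l = l₁ + l₂ :=
      ⟨min k 3, 3 - min k 3, k - min k 3, l - (3 - min k 3), by omega, by omega, by omega⟩
    obtain ⟨g₁, hg₁, hs₁⟩ := exists_mem_inf_segre_eq h₁
    obtain ⟨g₂, hg₂, hs₂⟩ := ih (k := k₂) (l := l₂) (by omega)
    refine ⟨g₂ * g₁, by rw [pow_succ]; exact Ideal.mul_mem_mul hg₂ hg₁, ?_⟩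
    rw [map_mul, hs₁, hs₂]
    ring

/-- The weight making the image of `segre` homogeneous of weight zero. -/
def balance : Fin 4 → ℤ := ![-1, -1, 1, 1]

theorem segre_isWeightedHomogeneous (f : FourPoly) :
    IsWeightedHomogeneous balance (segre f) 0 := by
  induction f using MvPolynomial.induction_on with
  | C c =>
    have : segre (C c) = C c := segre.commutes c
    rw [this]
    exact isWeightedHomogeneous_C _ _
  | add p q hp hq => rw [map_add]; exact hp.add hq
  | mul_X p i hp =>
    rw [map_mul, ← add_zero (0 : ℤ)]
    refine hp.mul ?_
    fin_cases i
    · simpa [balance] using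
        (isWeightedHomogeneous_X ℂ balance 0).mul (isWeightedHomogeneous_X ℂ balance 2)
    · simpa [balance] using
        (isWeightedHomogeneous_X ℂ balance 0).mul (isWeightedHomogeneous_X ℂ balance 3)
    · simpa [balance] using
        (isWeightedHomogeneous_X ℂ balance 1).mul (isWeightedHomogeneous_X ℂ balance 2)
    · simpa [balance] using
        (isWeightedHomogeneous_X ℂ balance 1).mul (isWeightedHomogeneous_X ℂ balance 3)

theorem tripleForm_isWeightedHomogeneous : IsWeightedHomogeneous balance tripleForm (-3) := by
  have h0 : IsWeightedHomogeneous balance (X 0 : FourPoly) (-1) :=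
    isWeightedHomogeneous_X ℂ balance 0
  have h1 : IsWeightedHomogeneous balance (X 1 : FourPoly) (-1) :=
    isWeightedHomogeneous_X ℂ balance 1
  exact (h0.mul h1).mul (h0.add h1)

theorem exists_mem_inf_pow_segre_eq_component (d : ℕ) (g : FourPoly) :
    ∃ p ∈ (Kz ⊓ Kz' ⊓ Kz'') ^ d,
      segre p = weightedHomogeneousComponent balance 0 (tripleForm ^ d * g) := by
  induction g using MvPolynomial.induction_on' with
  | add p q hp hq =>
    obtain ⟨p', hp', hps⟩ := hp
    obtain ⟨q', hq', hqs⟩ := hq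
    exact ⟨p' + q', add_mem hp' hq', by rw [map_add, hps, hqs, mul_add, map_add]⟩
  | monomial s c =>
    have hm : (monomial s c : FourPoly) =
        C c * (X 0 ^ s 0 * X 1 ^ s 1 * (X 2 ^ s 2 * X 3 ^ s 3)) := by
      rw [monomial_eq, Finsupp.prod_fintype _ _ (by simp), Fin.prod_univ_four]
      ring
    have hw : IsWeightedHomogeneous balance (tripleForm ^ d * monomial s c)
        (d • (-3) + Finsupp.weight balance s) :=
      (tripleForm_isWeightedHomogeneous.pow d).mul (isWeightedHomogeneous_monomial _ _ _ rfl)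
    have hs : Finsupp.weight balance s = (s 2 + s 3 : ℤ) - (s 0 + s 1) := by
      rw [Finsupp.weight_apply, Finsupp.sum_fintype _ _ (by simp), Fin.sum_univ_four]
      simp [balance]
      ring
    by_cases h : d • (-3) + Finsupp.weight balance s = 0
    · rw [h] at hw
      rw [hw.weightedHomogeneousComponent_same]
      rw [hs, nsmul_eq_mul] at h
      obtain ⟨p, hp, hps⟩ := exists_mem_inf_pow_segre_eq d (i := s 0) (j := s 1) (k := s 2)
        (l := s 3) (by omega)
      refine ⟨C c * p, Ideal.mul_mem_left _ _ hp, ?_⟩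
      have hc : segre (C c) = C c := segre.commutes c
      rw [map_mul, hc, hps, hm]
      ring
    · exact ⟨0, zero_mem _, by rw [hw.weightedHomogeneousComponent_ne _ (Ne.symm h), map_zero]⟩

theorem pow_dvd_segre {I : Ideal FourPoly} {a : FourPoly}
    (h : I ≤ (Ideal.span {a}).comap segre.toRingHom) {d : ℕ} {f : FourPoly} (hf : f ∈ I ^ d) :
    a ^ d ∣ segre f := by
  have h' := Ideal.le_comap_pow segre.toRingHom d (Ideal.pow_right_mono h d hf)
  rwa [Ideal.mem_comap, Ideal.span_singleton_pow, Ideal.mem_span_singleton] at h'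

theorem tripleForm_pow_dvd_segre {d : ℕ} {f : FourPoly}
    (hf : f ∈ Kz ^ d ⊓ Kz' ^ d ⊓ Kz'' ^ d) : tripleForm ^ d ∣ segre f := by
  obtain ⟨⟨hf₁, hf₂⟩, hf₃⟩ := hf
  have h₁ : (X 0 : FourPoly) ^ d ∣ segre f := by
    refine pow_dvd_segre ?_ hf₁
    rw [Kz, Ideal.span_le]
    rintro x (rfl | rfl) <;> simp [Ideal.mem_span_singleton]
  have h₂ : (X 1 : FourPoly) ^ d ∣ segre f := by
    refine pow_dvd_segre ?_ hf₂
    rw [Kz', Ideal.span_le]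
    rintro x (rfl | rfl) <;> simp [Ideal.mem_span_singleton]
  have h₃ : (X 0 + X 1 : FourPoly) ^ d ∣ segre f := by
    refine pow_dvd_segre ?_ hf₃
    rw [Kz'', Ideal.span_le]
    rintro x (rfl | rfl) <;> simp [Ideal.mem_span_singleton, ← add_mul]
  have hX0 : Prime (X 0 : FourPoly) := X_prime
  have hX1 : Prime (X 1 : FourPoly) := X_prime
  have h01 : ¬ (X 0 : FourPoly) ∣ X 1 := by simp [X_dvd_X]
  have h10 : ¬ (X 1 : FourPoly) ∣ X 0 := by simp [X_dvd_X]
  obtain ⟨p, hp⟩ := h₃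
  rw [hp] at h₁ h₂ ⊢
  obtain ⟨q, rfl⟩ := hX0.pow_dvd_of_dvd_mul_left d
    (fun h => h01 ((dvd_add_right dvd_rfl).1 (hX0.dvd_of_dvd_pow h))) h₁
  rw [← mul_assoc] at h₂
  obtain ⟨r, rfl⟩ := hX1.pow_dvd_of_dvd_mul_left d (fun h => (hX1.dvd_or_dvd h).elim
    (fun h => h10 ((dvd_add_left dvd_rfl).1 (hX1.dvd_of_dvd_pow h)))
    (fun h => h10 (hX1.dvd_of_dvd_pow h))) h₂
  exact ⟨r, by rw [tripleForm, mul_pow, mul_pow]; ring⟩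

theorem inf_pow_le_pow_inf (d : ℕ) :
    (Kz ⊓ Kz' ⊓ Kz'') ^ d ≤ Kz ^ d ⊓ Kz' ^ d ⊓ Kz'' ^ d :=
  le_inf (le_inf (Ideal.pow_right_mono (inf_le_left.trans inf_le_left) d)
    (Ideal.pow_right_mono (inf_le_left.trans inf_le_right) d))
    (Ideal.pow_right_mono inf_le_right d)

theorem pow_inf_le_inf_pow (d : ℕ) :
    Kz ^ d ⊓ Kz' ^ d ⊓ Kz'' ^ d ≤ (Kz ⊓ Kz' ⊓ Kz'') ^ d := by
  induction d with
  | zero => simp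
  | succ d ih =>
    intro f hf
    obtain ⟨q, hq⟩ := tripleForm_pow_dvd_segre hf
    obtain ⟨g, hg, hgs⟩ := exists_mem_inf_pow_segre_eq_component (d + 1) q
    rw [← hq, (segre_isWeightedHomogeneous f).weightedHomogeneousComponent_same] at hgs
    obtain ⟨r, hr⟩ := detPoly_dvd_of_segre_eq_zero (f := f - g) (by rw [map_sub, hgs, sub_self])
    have hfg := sub_mem hf (inf_pow_le_pow_inf (d + 1) hg)
    rw [hr] at hfg
    have hrd : r ∈ (Kz ⊓ Kz' ⊓ Kz'') ^ d :=
      ih ⟨⟨mem_Kz_pow_of_detPoly_mul_mem hfg.1.1, mem_Kz'_pow_of_detPoly_mul_mem hfg.1.2⟩,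
        mem_Kz''_pow_of_detPoly_mul_mem hfg.2⟩
    rw [← sub_add_cancel f g, hr]
    refine add_mem ?_ hg
    rw [pow_succ']
    exact Ideal.mul_mem_mul detPoly_mem_inf hrd

end

/-- For every d, (K ∩ K' ∩ K'')^d = K^d ∩ (K')^d ∩ (K'')^d. -/
theorem stmt1 (d : ℕ) :
    (Kz ⊓ Kz' ⊓ Kz'') ^ d = Kz ^ d ⊓ Kz' ^ d ⊓ Kz'' ^ d :=
  le_antisymm (inf_pow_le_pow_inf d) (pow_inf_le_inf_pow d)
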